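/- Deterministic core of the SparsePhaseMax theorem: Let x0 ∈ ℝⁿ with ‖x0‖₂ = 1 and |supp(x0)| ≤ k, let φ ∈ ℝⁿ with ‖φ‖₂ = 1 and α := ⟨φ, x0⟩ ∈ (0, 1], let λ > 0 with ξ := λ√k satisfying (1/2)·α < ξ < (3/4)·α, let 0 ≤ δ < α/20, and set s = (3.5²/ξ²)·k with s ≤ n. Suppose the measurement vectors a_1, …, a_m ∈ ℝⁿ satisfy the tessellation property: for all x, x̂ ∈ ℝⁿ with ‖x‖₂ = ‖x̂‖₂ = 1, ‖x‖₁ ≤ √s and ‖x̂‖₁ ≤ √s, if ⟨a_i, x̂⟩·⟨a_i, x⟩ ≥ 0 for every i = 1…m then ‖x̂ − x‖₂ ≤ δ. Then x0 is the unique maximizer of the program: maximize ⟨φ, x⟩ − λ‖x‖₁ over x ∈ ℝⁿ subject to −|⟨a_i, x0⟩| ≤ ⟨a_i, x⟩ ≤ |⟨a_i, x0⟩| for all i = 1…m. -/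

import Mathlib

/-- The ℓ² (Euclidean) norm on ℝⁿ. -/
noncomputable def l2norm {n : ℕ} (x : Fin n → ℝ) : ℝ := Real.sqrt (∑ j, (x j) ^ 2)

/-- The ℓ¹ norm on ℝⁿ. -/
noncomputable def l1norm {n : ℕ} (x : Fin n → ℝ) : ℝ := ∑ j, |x j|

/-- The Euclidean inner product on ℝⁿ. -/
noncomputable def dot {n : ℕ} (x y : Fin n → ℝ) : ℝ := ∑ j, x j * y j

theorem l2norm_eq_norm {n : ℕ} (x : Fin n → ℝ) : l2norm x = ‖WithLp.toLp 2 x‖ := by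
  simp [l2norm, EuclideanSpace.norm_eq]

theorem l2norm_pos {n : ℕ} {x : Fin n → ℝ} (hx : x ≠ 0) : 0 < l2norm x := by
  rw [l2norm_eq_norm, norm_pos_iff]
  simpa using hx

theorem l2norm_add_le {n : ℕ} (x y : Fin n → ℝ) : l2norm (x + y) ≤ l2norm x + l2norm y := by
  simpa only [l2norm_eq_norm, WithLp.toLp_add] using norm_add_le _ _

theorem l2norm_smul {n : ℕ} (c : ℝ) (x : Fin n → ℝ) : l2norm (c • x) = |c| * l2norm x := by
  simp only [l2norm_eq_norm, WithLp.toLp_smul, norm_smul, Real.norm_eq_abs]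

theorem l1norm_smul {n : ℕ} (c : ℝ) (x : Fin n → ℝ) : l1norm (c • x) = |c| * l1norm x := by
  simp [l1norm, abs_mul, Finset.mul_sum]

theorem l1norm_add_le {n : ℕ} (x y : Fin n → ℝ) : l1norm (x + y) ≤ l1norm x + l1norm y := by
  simp only [l1norm, ← Finset.sum_add_distrib]
  exact Finset.sum_le_sum fun j _ => abs_add_le _ _

theorem dot_add {n : ℕ} (x y z : Fin n → ℝ) : dot x (y + z) = dot x y + dot x z := by
  simp [dot, mul_add, Finset.sum_add_distrib]

theorem dot_sub {n : ℕ} (x y z : Fin n → ℝ) : dot x (y - z) = dot x y - dot x z := by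
  simp [dot, mul_sub, Finset.sum_sub_distrib]

theorem dot_smul {n : ℕ} (c : ℝ) (x y : Fin n → ℝ) : dot x (c • y) = c * dot x y := by
  simp [dot, Finset.mul_sum, mul_left_comm]

/-- The Cauchy–Schwarz inequality. -/
theorem abs_dot_le {n : ℕ} (x y : Fin n → ℝ) : |dot x y| ≤ l2norm x * l2norm y := by
  have h := abs_real_inner_le_norm (WithLp.toLp 2 y) (WithLp.toLp 2 x)
  rw [← l2norm_eq_norm, ← l2norm_eq_norm, EuclideanSpace.inner_eq_star_dotProduct] at h
  simpa [dot, dotProduct, mul_comm] using h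

/-- The `ℓ¹` mass of `h` on the support of a `k`-sparse vector is at most `√k ‖h‖₂`. -/
theorem sum_support_abs_le {n k : ℕ} {x₀ : Fin n → ℝ} (hk : (Function.support x₀).ncard ≤ k)
    (h : Fin n → ℝ) :
    ∑ j with x₀ j ≠ 0, |h j| ≤ Real.sqrt k * l2norm h := by
  have hcard : ((Finset.univ.filter fun j => x₀ j ≠ 0).card : ℝ) ≤ k := by
    have : Function.support x₀ = (Finset.univ.filter fun j => x₀ j ≠ 0 : Finset (Fin n)) := by
      ext; simp
    rw [this, Set.ncard_coe_finset] at hk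
    exact_mod_cast hk
  rw [l2norm, ← Real.sqrt_mul (Nat.cast_nonneg k)]
  apply Real.le_sqrt_of_sq_le
  calc (∑ j with x₀ j ≠ 0, |h j|) ^ 2
      ≤ (Finset.univ.filter fun j => x₀ j ≠ 0).card * ∑ j with x₀ j ≠ 0, |h j| ^ 2 :=
        sq_sum_le_card_mul_sum_sq
    _ ≤ k * ∑ j, h j ^ 2 := by
        simp only [sq_abs]
        gcongr
        exact Finset.filter_subset _ _

theorem l1norm_sub_l1norm_le {n k : ℕ} {x₀ : Fin n → ℝ}
    (hk : (Function.support x₀).ncard ≤ k) (x : Fin n → ℝ) :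
    l1norm x₀ - l1norm x ≤ Real.sqrt k * l2norm (x₀ - x) := by
  refine le_trans ?_ (sum_support_abs_le hk _)
  rw [l1norm, l1norm, ← Finset.sum_sub_distrib, Finset.sum_filter]
  refine Finset.sum_le_sum fun j _ => ?_
  split_ifs with hj
  · exact abs_sub_abs_le_abs_sub _ _
  · simp [not_not.mp hj]

/-- The cone inequality for the error of a `k`-sparse vector. -/
theorem l1norm_sub_le {n k : ℕ} {x₀ : Fin n → ℝ}
    (hk : (Function.support x₀).ncard ≤ k) (x : Fin n → ℝ) :
    l1norm (x₀ - x) ≤ 2 * (Real.sqrt k * l2norm (x₀ - x)) + (l1norm x - l1norm x₀) := by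
  refine le_trans ?_ (add_le_add_left
    (mul_le_mul_of_nonneg_left (sum_support_abs_le hk (x₀ - x)) zero_le_two) _)
  rw [l1norm, l1norm, l1norm, ← Finset.sum_sub_distrib, Finset.sum_filter, Finset.mul_sum,
    ← Finset.sum_add_distrib]
  refine Finset.sum_le_sum fun j _ => ?_
  split_ifs with hj
  · have := abs_sub_abs_le_abs_sub (x₀ j) (x j)
    simp only [Pi.sub_apply]
    linarith
  · simp [not_not.mp hj]

/-- **Deterministic core of the SparsePhaseMax theorem.** Let `‖x0‖₂ = 1` be `k`-sparse,
`‖φ‖₂ = 1` with `α = ⟨φ, x0⟩ ∈ (0, 1]`, `ξ = λ√k ∈ ((1/2)·α, (3/4)·α)`, `0 ≤ δ < α/20`,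
and `s = (3.5²/ξ²)·k ≤ n`. If the measurement vectors `a₁, …, a_m` satisfy the tessellation
property at level `(s, δ)` — for all unit vectors `x, x̂` with `‖x‖₁, ‖x̂‖₁ ≤ √s`,
`⟨a i, x̂⟩·⟨a i, x⟩ ≥ 0` for all `i` implies `‖x̂ − x‖₂ ≤ δ` — then `x0` is the unique
maximizer of SparsePhaseMax. -/
theorem sparsePhaseMax_deterministic_core {n m k : ℕ} (x0 φ : Fin n → ℝ)
    (a : Fin m → Fin n → ℝ) (lam α ξ δ s : ℝ)
    (hx0 : l2norm x0 = 1) (hk : (Function.support x0).ncard ≤ k)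
    (hφ : l2norm φ = 1) (hα : α = dot φ x0) (hαpos : 0 < α) (hα1 : α ≤ 1)
    (hlam : 0 < lam) (hξ : ξ = lam * Real.sqrt k)
    (hξlo : (1 / 2) * α < ξ) (hξhi : ξ < (3 / 4) * α)
    (hδ0 : 0 ≤ δ) (hδ : δ < α / 20)
    (hs : s = 3.5 ^ 2 / ξ ^ 2 * k) (hsn : s ≤ n)
    (htess : ∀ x xhat : Fin n → ℝ,
      l2norm x = 1 → l2norm xhat = 1 →
      l1norm x ≤ Real.sqrt s → l1norm xhat ≤ Real.sqrt s →
      (∀ i, 0 ≤ dot (a i) xhat * dot (a i) x) →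
      l2norm (xhat - x) ≤ δ) :
    ∀ x : Fin n → ℝ,
      (∀ i, -|dot (a i) x0| ≤ dot (a i) x ∧ dot (a i) x ≤ |dot (a i) x0|) →
      x ≠ x0 →
      dot φ x - lam * l1norm x < dot φ x0 - lam * l1norm x0 := by
  intro x hx hne
  by_contra! hobj
  set u := x0 - x with hu
  set v := x0 + x with hv
  have hup : 0 < l2norm u := l2norm_pos (sub_ne_zero.mpr hne.symm)
  have hφu : dot φ u ≤ lam * (l1norm x0 - l1norm x) := by
    rw [hu, dot_sub]; linarith
  have hφv : dot φ v = 2 * α - dot φ u := by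
    rw [hu, hv, dot_sub, dot_add, hα]; ring
  have hT : lam * (l1norm x0 - l1norm x) ≤ ξ * l2norm u := by
    rw [hξ, mul_assoc]
    exact mul_le_mul_of_nonneg_left (l1norm_sub_l1norm_le hk x) hlam.le
  have hx0l1 : lam * l1norm x0 ≤ ξ := by
    have h := l1norm_sub_l1norm_le hk 0
    rw [sub_zero, hx0, mul_one] at h
    rw [hξ]
    gcongr
    simpa [l1norm] using h
  have hul1 : lam * l1norm u ≤ 3.5 * l2norm u := by
    have h := mul_le_mul_of_nonneg_left (l1norm_sub_le hk x) hlam.le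
    have hcs := (abs_le.mp (abs_dot_le φ u)).1
    rw [hφ, one_mul] at hcs
    have hξu : lam * (Real.sqrt k * l2norm u) = ξ * l2norm u := by rw [hξ]; ring
    nlinarith
  have hvl1 : lam * l1norm v ≤ l2norm v := by
    have h := mul_le_mul_of_nonneg_left (l1norm_add_le x0 x) hlam.le
    have hcs := (abs_le.mp (abs_dot_le φ v)).2
    rw [hφ, one_mul] at hcs
    linarith
  have hvp : 0 < l2norm v := by
    refine l2norm_pos fun h0 => ?_
    have hx' : x = -x0 := (neg_eq_of_add_eq_zero_right h0).symm
    have h1 : l1norm x = l1norm x0 := by simp [hx', l1norm]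
    have h2 : dot φ v = 0 := by simp [h0, dot]
    rw [h1, sub_self, mul_zero] at hφu
    linarith
  have hξpos : 0 < ξ := by linarith
  have hsqrt : lam * Real.sqrt s = 3.5 := by
    have : s = (3.5 / ξ) ^ 2 * k := by rw [hs, div_pow]
    rw [this, Real.sqrt_mul (sq_nonneg _), Real.sqrt_sq (by positivity), mul_left_comm, ← hξ,
      div_mul_cancel₀ _ hξpos.ne']
  have hunit {w : Fin n → ℝ} (hw : 0 < l2norm w) : l2norm ((l2norm w)⁻¹ • w) = 1 := by
    rw [l2norm_smul, abs_of_pos (inv_pos.mpr hw), inv_mul_cancel₀ hw.ne']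
  have hsparse {w : Fin n → ℝ} (hw : 0 < l2norm w) (h : lam * l1norm w ≤ 3.5 * l2norm w) :
      l1norm ((l2norm w)⁻¹ • w) ≤ Real.sqrt s := by
    rw [l1norm_smul, abs_of_pos (inv_pos.mpr hw), inv_mul_le_iff₀ hw]
    refine le_of_mul_le_mul_left ?_ hlam
    rwa [mul_left_comm, hsqrt, mul_comm (l2norm w)]
  set u' := (l2norm u)⁻¹ • u with hu'
  set v' := (l2norm v)⁻¹ • v with hv'
  have hclose : l2norm (u' - v') ≤ δ := by
    refine htess v' u' (hunit hvp) (hunit hup) (hsparse hvp (by linarith)) (hsparse hup hul1)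
      fun i => ?_
    have hsq : dot (a i) x ^ 2 ≤ dot (a i) x0 ^ 2 := sq_le_sq.mpr (abs_le.mpr (hx i))
    have hprod : 0 ≤ dot (a i) u * dot (a i) v := by
      rw [hu, hv, dot_sub, dot_add]; linarith
    rw [hu', hv', dot_smul, dot_smul, mul_mul_mul_comm]
    positivity
  have hsum : (l2norm u + l2norm v) • u' = (2 : ℝ) • x0 + l2norm v • (u' - v') := by
    have h1 : l2norm u • u' = u := smul_inv_smul₀ hup.ne' u
    have h2 : l2norm v • v' = v := smul_inv_smul₀ hvp.ne' v
    rw [add_smul, smul_sub, h1, h2, hu, hv]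
    module
  have hle : l2norm v * l2norm (u' - v') ≤ l2norm v * δ :=
    mul_le_mul_of_nonneg_left hclose hvp.le
  have hnorm : l2norm u + l2norm v ≤ 2 + l2norm v * δ := by
    have h := l2norm_add_le ((2 : ℝ) • x0) (l2norm v • (u' - v'))
    rw [← hsum, l2norm_smul _ u', l2norm_smul _ x0, l2norm_smul _ (u' - v'),
      show l2norm u' = 1 from hunit hup, hx0, abs_of_pos hvp, abs_of_pos (add_pos hup hvp),
      abs_two] at h
    linarith
  have hφu' : dot φ u' ≤ ξ := by
    rw [hu', dot_smul, inv_mul_le_iff₀ hup]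
    linarith
  have hlow : 2 * α - l2norm v * δ ≤ (l2norm u + l2norm v) * dot φ u' := by
    rw [← dot_smul, hsum, dot_add, dot_smul, dot_smul, ← hα]
    have hcs := (abs_le.mp (abs_dot_le φ (u' - v'))).1
    rw [hφ, one_mul] at hcs
    nlinarith
  have hup' : (l2norm u + l2norm v) * dot φ u' ≤ (l2norm u + l2norm v) * (3 / 4 * α) := by
    gcongr
    linarith
  have hvδ : l2norm v * δ ≤ (l2norm u + l2norm v) * (α / 20) := by
    gcongr
    linarith
  have hsmall : l2norm u + l2norm v < 5 / 2 := by nlinarith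
  nlinarith
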